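/- Let n ≥ 1, let λ be a B-partition of n and set ν = ν(λ) = λ^t ∖ μ(λ). If the smallest part of ν is even, then ν^− is quasi-special; if the smallest part of ν is odd, then ν^− is special. In either case the C-collapse (ν^−)_C is special (specialness in the e-count sense). -/

import Mathlib

namespace WFPaper

/-- The list of parts of a partition (multiset of positive integers) in weakly
decreasing order. -/
def sortedDesc (s : Multiset ℕ) : List ℕ := (s.sort (· ≤ ·)).reverse

/-- The `j`-th largest part of `s` (1-indexed); `0` if `j = 0` or `j > #s`. -/
def part (s : Multiset ℕ) (j : ℕ) : ℕ := (sortedDesc s).getD (j - 1) 0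

/-- The smallest part of `s` (`0` if `s` is empty). -/
def minPart (s : Multiset ℕ) : ℕ := (s.sort (· ≤ ·)).getD 0 0

/-- Sum of the `j` largest parts of `s`. -/
def psum (s : Multiset ℕ) (j : ℕ) : ℕ := ((sortedDesc s).take j).sum

/-- Dominance order: `DomLE a b` means `a ≤ b` in the dominance order, i.e.
for every `j` the sum of the `j` largest parts of `a` is at most that of `b`. -/
def DomLE (a b : Multiset ℕ) : Prop := ∀ j, psum a j ≤ psum b j

/-- All parts are positive. -/
def PosParts (s : Multiset ℕ) : Prop := ∀ x ∈ s, 0 < x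

/-- A partition of an odd number in which every even part has even multiplicity
(a B-partition of `n` when the sum is `2*n+1`). -/
def IsTypeB (s : Multiset ℕ) : Prop :=
  PosParts s ∧ Odd s.sum ∧ ∀ x, Even x → Even (s.count x)

/-- A partition of an even number in which every odd part has even multiplicity
(a C-partition of `n` when the sum is `2*n`). -/
def IsTypeC (s : Multiset ℕ) : Prop :=
  PosParts s ∧ Even s.sum ∧ ∀ x, Odd x → Even (s.count x)

/-- A partition of an even number in which every even part has even multiplicity
(a D-partition of `n` when the sum is `2*n`). -/
def IsTypeD (s : Multiset ℕ) : Prop :=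
  PosParts s ∧ Even s.sum ∧ ∀ x, Even x → Even (s.count x)

/-- `IsCollapse T α β` : `β` is the dominance-largest partition of class `T` of
the same number as `α` which is dominated by `α` (e.g. the B/C/D-collapse of `α`
for `T = IsTypeB/IsTypeC/IsTypeD`). -/
def IsCollapse (T : Multiset ℕ → Prop) (α β : Multiset ℕ) : Prop :=
  T β ∧ β.sum = α.sum ∧ DomLE β α ∧
    ∀ γ, T γ → γ.sum = α.sum → DomLE γ α → DomLE γ β

/-- The transpose (conjugate) partition: its `j`-th part (0-indexed `j`) is the
number of parts of `s` that are `≥ j+1`. -/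
def transpose (s : Multiset ℕ) : Multiset ℕ :=
  (Multiset.range (part s 1)).map (fun j => (s.filter (fun x => j + 1 ≤ x)).card)

/-- `λ⁻` : subtract 1 from the smallest part (the part being deleted if it
becomes 0). -/
def decMin (s : Multiset ℕ) : Multiset ℕ :=
  ((minPart s - 1) ::ₘ s.erase (minPart s)).filter (fun x => 0 < x)

/-- `λ⁺` : add 1 to the largest part. -/
def incMax (s : Multiset ℕ) : Multiset ℕ :=
  (part s 1 + 1) ::ₘ s.erase (part s 1)

/-- The subpartition `μ` of `T` whose multiplicity at an even `x` is 2 if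
`m_T(x)` is even and nonzero, 1 if `m_T(x)` is odd, and 0 at odd `x`. -/
def muEven (T : Multiset ℕ) : Multiset ℕ :=
  (T.toFinset.filter (fun x => Even x)).val.bind
    (fun x => Multiset.replicate (if Even (T.count x) then 2 else 1) x)

/-- The subpartition `μ` of `T` whose multiplicity at an odd `x` is 2 if
`m_T(x)` is even and nonzero, 1 if `m_T(x)` is odd, and 0 at even `x`. -/
def muOdd (T : Multiset ℕ) : Multiset ℕ :=
  (T.toFinset.filter (fun x => Odd x)).val.bind
    (fun x => Multiset.replicate (if Even (T.count x) then 2 else 1) x)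

/-- The subpartition `π` of `T` consisting of the even parts of `T` of odd
multiplicity, each taken once. -/
def piEven (T : Multiset ℕ) : Multiset ℕ :=
  (T.toFinset.filter (fun x => Even x ∧ Odd (T.count x))).val

/-- `k` is a (1-indexed) position of an odd part of `s`. -/
def OddIdx (s : Multiset ℕ) (k : ℕ) : Prop := 1 ≤ k ∧ Odd (part s k)

/-- `k` is a (1-indexed) position of an even part of `s`. -/
def EvenIdx (s : Multiset ℕ) (k : ℕ) : Prop :=
  1 ≤ k ∧ k ≤ Multiset.card s ∧ Even (part s k)

/-- `e_s(i,j)` : number of positions `i ≤ k ≤ j` with `s_k` even. -/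
def eCount (s : Multiset ℕ) (i j : ℕ) : ℕ :=
  ((Finset.Icc i j).filter (fun k => Even (part s k))).card

/-- number of positions `i ≤ k ≤ j` with `s_k` odd. -/
def oCount (s : Multiset ℕ) (i j : ℕ) : ℕ :=
  ((Finset.Icc i j).filter (fun k => Odd (part s k))).card

/-- `s` is special in the e-count sense: `e_s(1,t₁)` is even, and
`e_s(tᵢ,tᵢ₊₁)` is even for all `1 ≤ i ≤ p-1`, where `t₁ < ⋯ < t_p` are the
positions of the odd parts of `s`. -/
def IsSpecialE (s : Multiset ℕ) : Prop :=
  (∀ t, OddIdx s t → (∀ t', OddIdx s t' → t ≤ t') → Even (eCount s 1 t)) ∧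
  (∀ i j, OddIdx s i → OddIdx s j → i < j →
    (∀ k, OddIdx s k → k ≤ i ∨ j ≤ k) → Even (eCount s i j))

/-- `s` is quasi-special: `e_s(1,t₁)` is even, `e_s(tᵢ,tᵢ₊₁)` is even for all
`1 ≤ i ≤ p-2`, and the smallest part of `s` is odd with multiplicity 1. -/
def IsQuasiSpecialE (s : Multiset ℕ) : Prop :=
  (∀ t, OddIdx s t → (∀ t', OddIdx s t' → t ≤ t') → Even (eCount s 1 t)) ∧
  (∀ i j, OddIdx s i → OddIdx s j → i < j →
    (∀ k, OddIdx s k → k ≤ i ∨ j ≤ k) → (∃ k, OddIdx s k ∧ j < k) →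
      Even (eCount s i j)) ∧
  Odd (minPart s) ∧ s.count (minPart s) = 1

/-- Number of odd parts greater than every even part (equals the number of odd
parts greater than the largest even part, and the number of all odd parts if
there are no even parts). -/
def numOddDominant (s : Multiset ℕ) : ℕ :=
  (s.filter (fun x => Odd x ∧ ∀ y ∈ s, Even y → y < x)).card

/-- Between every pair of consecutive even parts of `s` (in the decreasing
listing of the parts) there is an even number of odd parts. -/
def EvenBetween (s : Multiset ℕ) : Prop :=
  ∀ i j, EvenIdx s i → EvenIdx s j → i < j →
    (∀ k, EvenIdx s k → k ≤ i ∨ j ≤ k) → Even (oCount s i j)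

/-- A special B-partition. -/
def IsSpecialTypeB (s : Multiset ℕ) : Prop :=
  IsTypeB s ∧ EvenBetween s ∧ Odd (numOddDominant s)

/-- A special D-partition. -/
def IsSpecialTypeD (s : Multiset ℕ) : Prop :=
  IsTypeD s ∧ EvenBetween s ∧ Even (numOddDominant s)

/-! ### Parts as a weakly decreasing function -/

lemma coe_sortedDesc (s : Multiset ℕ) : (sortedDesc s : Multiset ℕ) = s := by
  rw [sortedDesc, Multiset.coe_reverse, Multiset.sort_eq]

lemma length_sortedDesc (s : Multiset ℕ) : (sortedDesc s).length = Multiset.card s := by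
  simp [sortedDesc]

lemma part_antitone (s : Multiset ℕ) : Antitone (fun k => part s (k + 1)) := by
  have hs : (sortedDesc s).Pairwise (· ≥ ·) := by
    rw [sortedDesc, List.pairwise_reverse]
    exact Multiset.pairwise_sort s (· ≤ ·)
  intro i j hij
  simp only [part, Nat.add_sub_cancel]
  rcases lt_or_ge j (sortedDesc s).length with hj | hj
  · have hi : i < (sortedDesc s).length := by omega
    rw [List.getD_eq_getElem _ _ hj, List.getD_eq_getElem _ _ hi]
    rcases hij.lt_or_eq with h | h
    · exact List.pairwise_iff_getElem.1 hs i j hi hj h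
    · subst h; exact le_rfl
  · rw [List.getD_eq_default _ _ hj]
    exact Nat.zero_le _

lemma part_eq_zero {s : Multiset ℕ} {k : ℕ} (hk : Multiset.card s ≤ k) : part s (k + 1) = 0 := by
  simp only [part, Nat.add_sub_cancel]
  exact List.getD_eq_default _ _ (by rwa [length_sortedDesc])

lemma map_part_range (s : Multiset ℕ) :
    (Multiset.range (Multiset.card s)).map (fun k => part s (k + 1)) = s := by
  conv_rhs => rw [← coe_sortedDesc s]
  rw [← length_sortedDesc s, ← Multiset.coe_range, Multiset.map_coe]
  congr 1
  refine List.ext_getElem (by simp) fun i h₁ h₂ => ?_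
  simp [part, h₂]

lemma sum_take_eq_sum_getD (L : List ℕ) (j : ℕ) :
    (L.take j).sum = ∑ k ∈ Finset.range j, L.getD k 0 := by
  induction L generalizing j with
  | nil => simp
  | cons a L ih =>
    cases j with
    | zero => simp
    | succ j => rw [Finset.sum_range_succ']; simp [ih, add_comm]

lemma psum_succ (s : Multiset ℕ) (j : ℕ) : psum s (j + 1) = psum s j + part s (j + 1) := by
  simp only [psum, part, sum_take_eq_sum_getD, Finset.sum_range_succ, Nat.add_sub_cancel]

lemma psum_zero (s : Multiset ℕ) : psum s 0 = 0 := by simp [psum]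

lemma psum_eq_sum {s : Multiset ℕ} {j : ℕ} (hj : Multiset.card s ≤ j) : psum s j = s.sum := by
  rw [psum, List.take_of_length_le (by rwa [length_sortedDesc]), ← Multiset.sum_coe,
    coe_sortedDesc]

lemma filter_lt_range {f : ℕ → ℕ} (hf : Antitone f) (x N : ℕ) :
    ∃ c ≤ N, (Finset.range N).filter (fun k => x < f k) = Finset.range c := by
  induction N with
  | zero => exact ⟨0, le_rfl, by simp⟩
  | succ N ih =>
    by_cases h : x < f N
    · refine ⟨N + 1, le_rfl, Finset.filter_true_of_mem fun k hk => ?_⟩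
      have : k ≤ N := by simpa [Nat.lt_succ_iff] using hk
      exact h.trans_le (hf this)
    · obtain ⟨c, hc, e⟩ := ih
      exact ⟨c, by omega, by rw [Finset.range_add_one, Finset.filter_insert, if_neg h, e]⟩

lemma card_filter_map_range (f : ℕ → ℕ) (N : ℕ) (p : ℕ → Prop) [DecidablePred p] :
    Multiset.card (((Multiset.range N).map f).filter p) =
      ((Finset.range N).filter (fun k => p (f k))).card := by
  rw [Multiset.filter_map, Multiset.card_map]
  rfl

lemma lt_iff_lt_card_filter {f : ℕ → ℕ} (hf : Antitone f) {N : ℕ} (hN : ∀ k, N ≤ k → f k = 0)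
    (x k : ℕ) :
    k < ((Finset.range N).filter (fun k => x < f k)).card ↔ x < f k := by
  obtain ⟨c, -, e⟩ := filter_lt_range hf x N
  rw [e, Finset.card_range, ← Finset.mem_range, ← e, Finset.mem_filter, Finset.mem_range]
  refine ⟨fun h => h.2, fun h => ⟨?_, h⟩⟩
  by_contra hk
  rw [hN k (by omega)] at h
  omega

lemma lt_card_filter_iff (s : Multiset ℕ) (x k : ℕ) :
    k < Multiset.card (s.filter (fun y => x < y)) ↔ x < part s (k + 1) := by
  conv_lhs => rw [← map_part_range s]
  rw [card_filter_map_range]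
  exact lt_iff_lt_card_filter (part_antitone s) (fun _ => part_eq_zero) x k

lemma part_filter_map_range {f : ℕ → ℕ} (hf : Antitone f) {N : ℕ} (hN : ∀ k, N ≤ k → f k = 0)
    (k : ℕ) : part (((Multiset.range N).map f).filter (fun x => 0 < x)) (k + 1) = f k := by
  refine eq_of_forall_lt_iff fun x => ?_
  rw [← lt_card_filter_iff, ← lt_iff_lt_card_filter hf hN, Multiset.filter_filter,
    ← card_filter_map_range f N (fun y => x < y)]
  have : ∀ y : ℕ, (x < y ∧ 0 < y) ↔ x < y := fun y => by omega
  simp only [this]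

lemma psum_card_filter (s : Multiset ℕ) (x : ℕ) :
    psum s (Multiset.card (s.filter (fun y => x < y))) = (s.filter (fun y => x < y)).sum := by
  obtain ⟨c, hc, e⟩ := filter_lt_range (part_antitone s) x (Multiset.card s)
  have hs := map_part_range s
  have h1 : Multiset.card (s.filter (fun y => x < y)) = c := by
    conv_lhs => rw [← hs]
    rw [card_filter_map_range, e, Finset.card_range]
  have h2 : (s.filter (fun y => x < y)).sum = ∑ k ∈ Finset.range c, part s (k + 1) := by
    conv_lhs => rw [← hs]
    rw [Multiset.filter_map, ← e]
    rfl
  rw [h1, h2, psum, sum_take_eq_sum_getD]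
  rfl

lemma part_mem {s : Multiset ℕ} {k : ℕ} (hk : 0 < part s (k + 1)) : part s (k + 1) ∈ s := by
  have hk' : k < Multiset.card s := by
    by_contra h
    rw [part_eq_zero (by omega)] at hk
    exact lt_irrefl _ hk
  have h : part s (k + 1) ∈ (Multiset.range (Multiset.card s)).map (fun k => part s (k + 1)) :=
    Multiset.mem_map_of_mem _ (Multiset.mem_range.2 hk')
  rwa [map_part_range] at h

lemma exists_part_eq {s : Multiset ℕ} {x : ℕ} (hx : x ∈ s) : ∃ k, part s (k + 1) = x := by
  rw [← map_part_range s, Multiset.mem_map] at hx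
  obtain ⟨k, -, hk⟩ := hx
  exact ⟨k, hk⟩

lemma two_le_count {s : Multiset ℕ} {i j : ℕ} (hij : i < j)
    (h : part s (i + 1) = part s (j + 1)) (h0 : 0 < part s (j + 1)) :
    2 ≤ s.count (part s (j + 1)) := by
  have hj : j < Multiset.card s := by
    by_contra hc
    rw [part_eq_zero (by omega)] at h0
    exact lt_irrefl _ h0
  have hc : s.count (part s (j + 1)) =
      ((Finset.range (Multiset.card s)).filter (fun k => part s (j + 1) = part s (k + 1))).card := by
    rw [Multiset.count_eq_card_filter_eq, ← card_filter_map_range (fun k => part s (k + 1)),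
      map_part_range]
  rw [hc, ← Finset.card_pair hij.ne]
  refine Finset.card_le_card fun k hk => ?_
  rw [Finset.mem_insert, Finset.mem_singleton] at hk
  rw [Finset.mem_filter, Finset.mem_range]
  rcases hk with rfl | rfl
  · exact ⟨hij.trans hj, h.symm⟩
  · exact ⟨hj, rfl⟩

lemma minPart_mem {s : Multiset ℕ} (hs : s ≠ 0) : minPart s ∈ s := by
  have h : 0 < (s.sort (· ≤ ·)).length := by
    rw [Multiset.length_sort]; exact Multiset.card_pos.2 hs
  rw [minPart, List.getD_eq_getElem _ _ h, ← Multiset.mem_sort (· ≤ ·)]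
  exact List.getElem_mem h

lemma minPart_le {s : Multiset ℕ} {x : ℕ} (hx : x ∈ s) : minPart s ≤ x := by
  have hp := Multiset.pairwise_sort s (· ≤ ·)
  rw [← Multiset.mem_sort (· ≤ ·)] at hx
  rw [minPart]
  generalize s.sort (· ≤ ·) = L at hp hx
  cases L with
  | nil => simp at hx
  | cons a L =>
    rcases List.mem_cons.1 hx with rfl | h
    · simp
    · simpa using (List.pairwise_cons.1 hp).1 x h

/-! ### Parity of sums and cardinalities -/

lemma even_card_of_even_count {s : Multiset ℕ} (h : ∀ x ∈ s, Even (s.count x)) :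
    Even (Multiset.card s) := by
  rw [← Multiset.toFinset_sum_count_eq]
  exact Finset.even_sum _ fun x hx => h x (Multiset.mem_toFinset.1 hx)

lemma even_sum_of_odd_count {s : Multiset ℕ} (h : ∀ x, Odd x → Even (s.count x)) :
    Even s.sum := by
  rw [Finset.sum_multiset_count]
  refine Finset.even_sum _ fun x _ => ?_
  rw [smul_eq_mul, Nat.even_mul]
  rcases Nat.even_or_odd x with hx | hx
  · exact Or.inr hx
  · exact Or.inl (h x hx)

/-- In a partition whose odd parts have even multiplicity, an odd partial sum stops between two
equal odd parts. -/
lemma part_eq_of_odd_psum {s : Multiset ℕ} (h : ∀ x, Odd x → Even (s.count x)) {k : ℕ}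
    (hk : Odd (psum s (k + 1))) :
    part s (k + 1) = part s (k + 2) ∧ Odd (part s (k + 1)) := by
  have hev : ∀ v, Even (psum s (Multiset.card (s.filter (fun y => v < y)))) := by
    intro v
    rw [psum_card_filter]
    refine even_sum_of_odd_count fun x hx => ?_
    rw [Multiset.count_filter]
    split_ifs
    · exact h x hx
    · exact Even.zero
  have heq : part s (k + 1) = part s (k + 2) := by
    by_contra hne
    have hlt : part s (k + 2) < part s (k + 1) :=
      lt_of_le_of_ne (part_antitone s (Nat.le_succ k)) (Ne.symm hne)
    have h1 := (lt_card_filter_iff s (part s (k + 2)) k).2 hlt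
    have h2 := (lt_card_filter_iff s (part s (k + 2)) (k + 1)).not.2 (lt_irrefl _)
    have h3 := hev (part s (k + 2))
    rw [show Multiset.card (s.filter (fun y => part s (k + 2) < y)) = k + 1 by omega] at h3
    exact Nat.not_even_iff_odd.2 hk h3
  refine ⟨heq, ?_⟩
  by_contra hno
  rw [Nat.not_odd_iff_even] at hno
  have key : ∀ j, Multiset.card (s.filter (fun y => part s (k + 1) < y)) ≤ j → j ≤ k + 1 →
      Even (psum s j) := by
    intro j hj
    induction j, hj using Nat.le_induction with
    | base => exact fun _ => hev _
    | succ j hj ih =>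
      intro hjk
      have h1 : part s (j + 1) ≤ part s (k + 1) :=
        not_lt.1 ((lt_card_filter_iff s (part s (k + 1)) j).not.1 (not_lt.2 hj))
      have h2 : part s (k + 1) ≤ part s (j + 1) :=
        part_antitone s (show j ≤ k by omega)
      rw [psum_succ, le_antisymm h1 h2]
      exact (ih (by omega)).add hno
  refine Nat.not_even_iff_odd.2 hk (key (k + 1) ?_ le_rfl)
  have := (lt_card_filter_iff s (part s (k + 1)) k).not.2 (lt_irrefl _)
  omega

/-- The converse of `part_eq_of_odd_psum`. -/
lemma even_count_of_psum {s : Multiset ℕ}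
    (h : ∀ k, Odd (psum s (k + 1)) → part s (k + 1) = part s (k + 2)) {x : ℕ} (hx : Odd x) :
    Even (s.count x) := by
  have hev : ∀ v, Even (s.filter (fun y => v < y)).sum := by
    intro v
    rw [← psum_card_filter]
    rcases hc : Multiset.card (s.filter (fun y => v < y)) with _ | k
    · rw [psum_zero]; exact Even.zero
    · by_contra hodd
      have heq := h k (Nat.not_even_iff_odd.1 hodd)
      have h1 := (lt_card_filter_iff s v k).1 (by omega)
      have h2 := (lt_card_filter_iff s v (k + 1)).not.1 (by omega)
      rw [heq] at h1
      exact h2 h1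
  obtain ⟨v, rfl⟩ : ∃ v, x = v + 1 := ⟨x - 1, by have := hx.pos; omega⟩
  have hsplit : s.filter (fun y => v < y) =
      s.filter (fun y => y = v + 1) + s.filter (fun y => v + 1 < y) := by
    have h0 := Multiset.filter_add_filter (fun y => y = v + 1) (fun y => v + 1 < y) s
    have h1 : ∀ y : ℕ, (y = v + 1 ∨ v + 1 < y) ↔ v < y := fun y => by omega
    have h2 : ∀ y : ℕ, ¬(y = v + 1 ∧ v + 1 < y) := fun y => by omega
    simp only [h1, h2, Multiset.filter_false, add_zero] at h0
    exact h0.symm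
  have hsum := hev v
  rw [hsplit, Multiset.sum_add, Nat.even_add, Multiset.filter_eq', Multiset.sum_replicate,
    smul_eq_mul, Nat.even_mul] at hsum
  exact (hsum.2 (hev (v + 1))).resolve_right (Nat.not_even_iff_odd.2 hx)

/-! ### The number of even parts exceeding a bound -/

/-- The number of even parts of `s` larger than `x`. -/
def evenAbove (s : Multiset ℕ) (x : ℕ) : ℕ :=
  Multiset.card (s.filter (fun y => Even y ∧ x < y))

lemma eCount_one_eq {s : Multiset ℕ} {t : ℕ} (ht : OddIdx s t) :
    eCount s 1 t = evenAbove s (part s t) := by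
  obtain ⟨t, rfl⟩ : ∃ k, t = k + 1 := ⟨t - 1, by have := ht.1; omega⟩
  have hodd := ht.2
  have hanti := part_antitone s
  have he : evenAbove s (part s (t + 1)) = ((Finset.range (Multiset.card s)).filter
      (fun k => Even (part s (k + 1)) ∧ part s (t + 1) < part s (k + 1))).card := by
    rw [← card_filter_map_range (fun k => part s (k + 1)) _
      (fun y => Even y ∧ part s (t + 1) < y), map_part_range]
    rfl
  rw [he, eCount]
  symm
  refine Finset.card_bij (fun k _ => k + 1) (fun k hk => ?_) (fun a _ b _ h => by omega)
    fun b hb => ?_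
  · rw [Finset.mem_filter] at hk
    rw [Finset.mem_filter, Finset.mem_Icc]
    refine ⟨⟨by omega, ?_⟩, hk.2.1⟩
    by_contra hlt
    have := hanti (show t ≤ k by omega)
    simp only at this
    omega
  · rw [Finset.mem_filter, Finset.mem_Icc] at hb
    obtain ⟨b, rfl⟩ : ∃ k, b = k + 1 := ⟨b - 1, by omega⟩
    have h1 : part s (t + 1) ≤ part s (b + 1) := hanti (show b ≤ t by omega)
    have h2 : part s (t + 1) ≠ part s (b + 1) := fun h =>
      Nat.not_even_iff_odd.2 hodd (h ▸ hb.2)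
    refine ⟨b, ?_, rfl⟩
    rw [Finset.mem_filter, Finset.mem_range]
    refine ⟨?_, hb.2, by omega⟩
    by_contra hc
    rw [part_eq_zero (by omega : Multiset.card s ≤ b)] at h1 h2
    omega

lemma eCount_one_add {s : Multiset ℕ} {i j : ℕ} (hi : OddIdx s i) (hij : i < j) :
    eCount s 1 j = eCount s 1 i + eCount s i j := by
  have hi1 := hi.1
  rw [eCount, eCount, eCount, ← Finset.card_union_of_disjoint]
  · congr 1
    ext k
    simp only [Finset.mem_union, Finset.mem_filter, Finset.mem_Icc]
    constructor
    · rintro ⟨h, h'⟩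
      rcases le_total k i with h1 | h1
      · exact Or.inl ⟨⟨h.1, h1⟩, h'⟩
      · exact Or.inr ⟨⟨h1, h.2⟩, h'⟩
    · rintro (⟨h, h'⟩ | ⟨h, h'⟩)
      · exact ⟨⟨h.1, by omega⟩, h'⟩
      · exact ⟨⟨by omega, h.2⟩, h'⟩
  · rw [Finset.disjoint_left]
    intro k h1 h2
    simp only [Finset.mem_filter, Finset.mem_Icc] at h1 h2
    obtain rfl : k = i := by omega
    exact Nat.not_even_iff_odd.2 hi.2 h1.2

lemma even_eCount {s : Multiset ℕ} {i j : ℕ} (hi : OddIdx s i) (hj : OddIdx s j) (hij : i < j)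
    (ei : Even (evenAbove s (part s i))) (ej : Even (evenAbove s (part s j))) :
    Even (eCount s i j) := by
  have h := eCount_one_add hi hij
  rw [eCount_one_eq hi, eCount_one_eq hj] at h
  rw [h, Nat.even_add] at ej
  exact ej.1 ei

lemma isSpecialE_of_even_evenAbove {s : Multiset ℕ}
    (h : ∀ t, OddIdx s t → Even (evenAbove s (part s t))) : IsSpecialE s :=
  ⟨fun t ht _ => by rw [eCount_one_eq ht]; exact h t ht,
    fun i j hi hj hij _ => even_eCount hi hj hij (h i hi) (h j hj)⟩

/-! ### Decreasing the smallest part of a partition of type B -/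

lemma IsTypeB.ne_zero {s : Multiset ℕ} (h : IsTypeB s) : s ≠ 0 := by
  rintro rfl
  simpa using h.2.1

lemma IsTypeB.exists_odd_mem {s : Multiset ℕ} (h : IsTypeB s) : ∃ x ∈ s, Odd x := by
  by_contra! hc
  refine Nat.not_even_iff_odd.2 h.2.1 (even_sum_of_odd_count fun x hx => ?_)
  rw [Multiset.count_eq_zero_of_notMem fun hm => hc x hm hx]
  exact Even.zero

lemma IsTypeB.even_evenAbove {s : Multiset ℕ} (h : IsTypeB s) (x : ℕ) :
    Even (evenAbove s x) := by
  refine even_card_of_even_count fun y hy => ?_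
  have hy' := (Multiset.mem_filter.1 hy).2
  rw [Multiset.count_filter, if_pos hy']
  exact h.2.2 y hy'.1

lemma evenAbove_decMin {s : Multiset ℕ} (hs : s ≠ 0) {x : ℕ} (hx : minPart s ≤ x) :
    evenAbove (decMin s) x = evenAbove s x := by
  have hc := Multiset.cons_erase (minPart_mem hs)
  unfold evenAbove decMin
  conv_rhs => rw [← hc, Multiset.filter_cons_of_neg _ (by omega)]
  rw [Multiset.filter_filter]
  have h0 : ∀ y : ℕ, ((Even y ∧ x < y) ∧ 0 < y) ↔ (Even y ∧ x < y) := fun y => by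
    constructor
    · exact fun h => h.1
    · exact fun h => ⟨h, by omega⟩
  simp only [h0]
  rw [Multiset.filter_cons_of_neg _ (by omega)]

lemma minPart_le_of_mem_decMin {s : Multiset ℕ} {x : ℕ} (hx : x ∈ decMin s)
    (hne : x ≠ minPart s - 1) : minPart s ≤ x := by
  rcases Multiset.mem_cons.1 (Multiset.mem_filter.1 hx).1 with h | h
  · exact absurd h hne
  · exact minPart_le (Multiset.mem_of_mem_erase h)

lemma IsTypeB.even_evenAbove_decMin {s : Multiset ℕ} (h : IsTypeB s) {x : ℕ} (hx : x ∈ decMin s)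
    (hne : x ≠ minPart s - 1) : Even (evenAbove (decMin s) x) := by
  rw [evenAbove_decMin h.ne_zero (minPart_le_of_mem_decMin hx hne)]
  exact h.even_evenAbove x

lemma IsTypeB.minPart_pos {s : Multiset ℕ} (h : IsTypeB s) : 0 < minPart s :=
  h.1 _ (minPart_mem h.ne_zero)

lemma IsTypeB.even_sum_decMin {s : Multiset ℕ} (h : IsTypeB s) : Even (decMin s).sum := by
  have h1 : (decMin s).sum = minPart s - 1 + (s.erase (minPart s)).sum := by
    have hsplit := Multiset.sum_filter_add_sum_filter_not
      (s := (minPart s - 1) ::ₘ s.erase (minPart s)) (p := fun x => 0 < x)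
    have h0 : (((minPart s - 1) ::ₘ s.erase (minPart s)).filter (fun x => ¬ 0 < x)).sum = 0 :=
      Multiset.sum_eq_zero fun x hx => by
        have := (Multiset.mem_filter.1 hx).2
        omega
    rwa [h0, Nat.add_zero, Multiset.sum_cons] at hsplit
  have h2 := congrArg Multiset.sum (Multiset.cons_erase (minPart_mem h.ne_zero))
  rw [Multiset.sum_cons] at h2
  have h3 := h.minPart_pos
  have h4 := h.2.1
  rw [Nat.odd_iff] at h4
  rw [Nat.even_iff]
  omega

lemma IsTypeB.count_decMin {s : Multiset ℕ} (h : IsTypeB s) (hm : Even (minPart s)) :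
    (decMin s).count (minPart s - 1) = 1 := by
  have h1 := h.minPart_pos
  have h2 := Nat.even_iff.1 hm
  rw [decMin, Multiset.count_filter_of_pos (by omega), Multiset.count_cons_self,
    Multiset.count_eq_zero_of_notMem]
  intro hmem
  have := minPart_le (Multiset.mem_of_mem_erase hmem)
  omega

lemma IsTypeB.isSpecialE_decMin {s : Multiset ℕ} (h : IsTypeB s) (hm : Odd (minPart s)) :
    IsSpecialE (decMin s) := by
  refine isSpecialE_of_even_evenAbove fun t ht => ?_
  obtain ⟨t, rfl⟩ : ∃ k, t = k + 1 := ⟨t - 1, by have := ht.1; omega⟩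
  refine h.even_evenAbove_decMin (part_mem ht.2.pos) ?_
  have h1 := Nat.odd_iff.1 ht.2
  have h2 := Nat.odd_iff.1 hm
  omega

/-- A part of `decMin s` occurring at least twice is not the decreased part, when odd. -/
lemma IsTypeB.part_ne_of_part_eq {s : Multiset ℕ} (h : IsTypeB s) {i j : ℕ} (hij : i < j)
    (heq : part (decMin s) (i + 1) = part (decMin s) (j + 1))
    (hodd : Odd (part (decMin s) (j + 1))) : part (decMin s) (j + 1) ≠ minPart s - 1 := by
  intro hc
  have h1 := two_le_count hij heq hodd.pos
  have h2 := h.minPart_pos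
  rw [hc] at h1 hodd
  have h3 : Even (minPart s) := by
    rw [Nat.odd_iff] at hodd
    rw [Nat.even_iff]
    omega
  rw [h.count_decMin h3] at h1
  omega

lemma minPart_eq {s : Multiset ℕ} {m : ℕ} (hm : m ∈ s) (hle : ∀ x ∈ s, m ≤ x) :
    minPart s = m :=
  le_antisymm (minPart_le hm) (hle _ (minPart_mem fun h => by simp [h] at hm))

lemma IsTypeB.isQuasiSpecialE_decMin {s : Multiset ℕ} (h : IsTypeB s) (hm : Even (minPart s)) :
    IsQuasiSpecialE (decMin s) := by
  have hpos := h.minPart_pos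
  have hmod := Nat.even_iff.1 hm
  have hcount := h.count_decMin hm
  have hmem : minPart s - 1 ∈ decMin s := Multiset.count_pos.1 (by omega)
  have hle : ∀ x ∈ decMin s, minPart s - 1 ≤ x := fun x hx => by
    by_cases hne : x = minPart s - 1
    · exact hne.ge
    · exact (Nat.sub_le _ _).trans (minPart_le_of_mem_decMin hx hne)
  have hmin : minPart (decMin s) = minPart s - 1 := minPart_eq hmem hle
  have hanti := part_antitone (decMin s)
  refine ⟨fun t ht hfirst => ?_, fun i j hi hj hij _ hk => ?_, ?_, by rw [hmin, hcount]⟩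
  · rw [eCount_one_eq ht]
    obtain ⟨t, rfl⟩ : ∃ k, t = k + 1 := ⟨t - 1, by have := ht.1; omega⟩
    refine h.even_evenAbove_decMin (part_mem ht.2.pos) ?_
    obtain ⟨y, hy, hyodd⟩ := h.exists_odd_mem
    have hy1 := minPart_le hy
    have hne : y ≠ minPart s := fun e => Nat.not_even_iff_odd.2 hyodd (e ▸ hm)
    have hy2 : y ∈ decMin s := Multiset.mem_filter.2
      ⟨Multiset.mem_cons_of_mem ((Multiset.mem_erase_of_ne hne).2 hy), hyodd.pos⟩
    obtain ⟨k, hk⟩ := exists_part_eq hy2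
    have h1 := hfirst (k + 1) ⟨by omega, by rwa [hk]⟩
    have h2 := hanti (show t ≤ k by omega)
    simp only [hk] at h2
    omega
  · obtain ⟨k, hk, hjk⟩ := hk
    obtain ⟨i, rfl⟩ : ∃ k, i = k + 1 := ⟨i - 1, by have := hi.1; omega⟩
    obtain ⟨j, rfl⟩ : ∃ k, j = k + 1 := ⟨j - 1, by have := hj.1; omega⟩
    obtain ⟨k, rfl⟩ : ∃ l, k = l + 1 := ⟨k - 1, by have := hk.1; omega⟩
    have h1 : part (decMin s) (j + 1) ≤ part (decMin s) (i + 1) := hanti (by omega)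
    have h2 : part (decMin s) (k + 1) ≤ part (decMin s) (j + 1) := hanti (by omega)
    have h3 := hle _ (part_mem hk.2.pos)
    have h4 : part (decMin s) (j + 1) ≠ minPart s - 1 := fun hc => by
      have heq : part (decMin s) (j + 1) = part (decMin s) (k + 1) := by omega
      exact h.part_ne_of_part_eq (by omega) heq hk.2 (heq ▸ hc)
    exact even_eCount hi hj hij
      (h.even_evenAbove_decMin (part_mem hi.2.pos) (by omega))
      (h.even_evenAbove_decMin (part_mem hj.2.pos) h4)
  · rw [hmin, Nat.odd_iff]
    omega

/-! ### Partial sums of the C-collapse -/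

open Classical in
/-- The drop of the `j`-th partial sum when passing from `s` to its C-collapse. -/
noncomputable def collapseDrop (s : Multiset ℕ) (j : ℕ) : ℕ :=
  if Odd (psum s j) ∧ ¬(part s j = part s (j + 1) ∧ Odd (part s j)) then 1 else 0

lemma collapseDrop_le_one (s : Multiset ℕ) (j : ℕ) : collapseDrop s j ≤ 1 := by
  unfold collapseDrop
  split_ifs <;> omega

lemma collapseDrop_of_even {s : Multiset ℕ} {j : ℕ} (h : Even (psum s j)) :
    collapseDrop s j = 0 :=
  if_neg fun hc => Nat.not_even_iff_odd.2 hc.1 h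

lemma collapseDrop_of_even_part {s : Multiset ℕ} {j : ℕ} (h : Odd (psum s j))
    (hp : Even (part s j)) : collapseDrop s j = 1 :=
  if_pos ⟨h, fun hc => Nat.not_even_iff_odd.2 hc.2 hp⟩

/-- The parts of the C-collapse of `s`, indexed from `0`. -/
noncomputable def collapsePart (s : Multiset ℕ) (k : ℕ) : ℕ :=
  part s (k + 1) + collapseDrop s k - collapseDrop s (k + 1)

lemma collapsePart_add (s : Multiset ℕ) (k : ℕ) :
    collapsePart s k + collapseDrop s (k + 1) = part s (k + 1) + collapseDrop s k := by
  refine Nat.sub_add_cancel ?_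
  have h1 := collapseDrop_le_one s (k + 1)
  by_cases h0 : part s (k + 1) = 0
  · by_cases hodd : Odd (psum s k)
    · obtain _ | k := k
      · simp [psum_zero] at hodd
      · by_cases hp : Even (part s (k + 1))
        · rw [collapseDrop_of_even_part hodd hp]; omega
        · have h2 : collapseDrop s (k + 1 + 1) ≤ collapseDrop s (k + 1) := by
            unfold collapseDrop
            rw [psum_succ s (k + 1), h0]
            have : 0 < part s (k + 1) := (Nat.not_even_iff_odd.1 hp).pos
            have h3 : part s (k + 1) ≠ 0 := by omega
            simp [h3, hodd]
          omega
    · rw [collapseDrop_of_even (j := k + 1)]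
      · omega
      · rw [psum_succ, h0]; exact Nat.not_odd_iff_even.1 hodd
  · omega

lemma sum_collapsePart (s : Multiset ℕ) (j : ℕ) :
    ∑ k ∈ Finset.range j, collapsePart s k + collapseDrop s j = psum s j := by
  induction j with
  | zero => simp [psum_zero, collapseDrop_of_even]
  | succ j ih =>
    rw [Finset.sum_range_succ, psum_succ]
    have := collapsePart_add s j
    omega

lemma collapsePart_antitone (s : Multiset ℕ) : Antitone (collapsePart s) := by
  refine antitone_nat_of_succ_le fun k => ?_
  have h1 := collapsePart_add s k
  have h2 := collapsePart_add s (k + 1)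
  have h3 : part s (k + 1 + 1) ≤ part s (k + 1) := part_antitone s (Nat.le_succ k)
  by_cases hd : collapseDrop s (k + 1) = 0
  · omega
  have hd1 : collapseDrop s (k + 1) = 1 := by
    have := collapseDrop_le_one s (k + 1)
    omega
  obtain ⟨hodd, hne⟩ : Odd (psum s (k + 1)) ∧
      ¬(part s (k + 1) = part s (k + 1 + 1) ∧ Odd (part s (k + 1))) := by
    by_contra hc
    exact hd (if_neg hc)
  have hleft : Even (part s (k + 1)) → collapseDrop s k = 1 := by
    intro he
    rw [psum_succ, Nat.odd_add] at hodd
    have hk := hodd.2 he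
    obtain _ | k := k
    · simp [psum_zero] at hk
    · unfold collapseDrop
      exact if_pos ⟨hk, fun hc => Nat.not_even_iff_odd.2 hc.2 (hc.1 ▸ he)⟩
  have hright : Even (part s (k + 1 + 1)) → collapseDrop s (k + 1 + 1) = 1 := fun he =>
    collapseDrop_of_even_part (by rw [psum_succ]; exact hodd.add_even he) he
  rcases Nat.even_or_odd (part s (k + 1)) with e1 | e1 <;>
  rcases Nat.even_or_odd (part s (k + 1 + 1)) with e2 | e2
  · have := hleft e1; have := hright e2; omega
  · have := hleft e1
    rw [Nat.even_iff] at e1; rw [Nat.odd_iff] at e2; omega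
  · have := hright e2
    rw [Nat.odd_iff] at e1; rw [Nat.even_iff] at e2; omega
  · have : part s (k + 1) ≠ part s (k + 1 + 1) := fun h => hne ⟨h, e1⟩
    rw [Nat.odd_iff] at e1 e2; omega

/-- An odd partial sum of a C-partition dominated by `s` drops by `collapseDrop` at least. -/
lemma psum_add_collapseDrop_le {s e : Multiset ℕ} (he : IsTypeC e) (hdom : DomLE e s) (j : ℕ) :
    psum e j + collapseDrop s j ≤ psum s j := by
  by_contra hlt
  have h1 := collapseDrop_le_one s j
  have h2 := hdom j
  have hd : collapseDrop s j ≠ 0 := by omega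
  obtain ⟨hodd, hne⟩ : Odd (psum s j) ∧ ¬(part s j = part s (j + 1) ∧ Odd (part s j)) := by
    by_contra hc
    exact hd (if_neg hc)
  obtain _ | k := j
  · simp [psum_zero] at hodd
  have heq : psum e (k + 1) = psum s (k + 1) := by omega
  obtain ⟨h3, h4⟩ : part e (k + 1) = part e (k + 1 + 1) ∧ Odd (part e (k + 1)) :=
    part_eq_of_odd_psum he.2.2 (heq ▸ hodd)
  have h5 := hdom k
  have h6 := hdom (k + 1 + 1)
  have h7 := psum_succ s k
  have h8 := psum_succ e k
  have h9 := psum_succ s (k + 1)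
  have h10 := psum_succ e (k + 1)
  have h11 : part s (k + 1 + 1) ≤ part s (k + 1) := part_antitone s (Nat.le_succ k)
  have h12 : part e (k + 1) = part s (k + 1) := by omega
  exact hne ⟨by omega, h12 ▸ h4⟩

/-- A partition of type C realizing the partial sums `psum s j - collapseDrop s j`. -/
lemma exists_isTypeC_psum {s : Multiset ℕ} (hs : Even s.sum) :
    ∃ b, IsTypeC b ∧ b.sum = s.sum ∧ ∀ j, psum b j + collapseDrop s j = psum s j := by
  have hN : ∀ k, Multiset.card s ≤ k → collapseDrop s k = 0 := fun k hk =>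
    collapseDrop_of_even (by rwa [psum_eq_sum hk])
  have hzero : ∀ k, Multiset.card s ≤ k → collapsePart s k = 0 := fun k hk => by
    rw [collapsePart, part_eq_zero hk, hN k hk, Nat.zero_add, Nat.zero_sub]
  set b := ((Multiset.range (Multiset.card s)).map (collapsePart s)).filter (fun x => 0 < x)
    with hb
  have hpart : ∀ k, part b (k + 1) = collapsePart s k :=
    part_filter_map_range (collapsePart_antitone s) hzero
  have hpsum : ∀ j, psum b j + collapseDrop s j = psum s j := fun j => by
    rw [← sum_collapsePart s, psum, sum_take_eq_sum_getD]
    congr 1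
    exact Finset.sum_congr rfl fun k _ => hpart k
  have hcard : Multiset.card b ≤ Multiset.card s := by
    refine (Multiset.card_le_card (Multiset.filter_le _ _)).trans ?_
    simp
  have hsum : b.sum = s.sum := by
    have := hpsum (Multiset.card s)
    rwa [hN _ le_rfl, Nat.add_zero, psum_eq_sum hcard, psum_eq_sum le_rfl] at this
  refine ⟨b, ⟨fun x hx => (Multiset.mem_filter.1 hx).2, hsum ▸ hs, fun x hx => ?_⟩, hsum, hpsum⟩
  refine even_count_of_psum (fun k hk => ?_) hx
  have h1 := hpsum (k + 1)
  have h2 := collapseDrop_le_one s (k + 1)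
  have hodd : Odd (psum s (k + 1)) := by
    by_contra hc
    rw [collapseDrop_of_even (Nat.not_odd_iff_even.1 hc)] at h1
    exact hc (h1 ▸ hk)
  have hd : collapseDrop s (k + 1) = 0 := by
    rw [Nat.odd_iff] at hk hodd
    omega
  obtain ⟨h3, h4⟩ : part s (k + 1) = part s (k + 1 + 1) ∧ Odd (part s (k + 1)) := by
    by_contra hc
    rw [collapseDrop, if_pos ⟨hodd, hc⟩] at hd
    omega
  have h5 : collapseDrop s k = 0 := collapseDrop_of_even (by
    rw [psum_succ, Nat.odd_add'] at hodd
    exact hodd.1 h4)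
  have h6 : collapseDrop s (k + 1 + 1) = 0 := collapseDrop_of_even (by
    rw [psum_succ, ← h3]
    exact hodd.add_odd h4)
  have h7 := collapsePart_add s k
  have h8 := collapsePart_add s (k + 1)
  rw [hpart, hpart]
  omega

lemma IsCollapse.psum_add_collapseDrop {s e : Multiset ℕ} (hs : Even s.sum)
    (h : IsCollapse IsTypeC s e) (j : ℕ) : psum e j + collapseDrop s j = psum s j := by
  obtain ⟨b, hb, hsum, hpsum⟩ := exists_isTypeC_psum hs
  have h1 := psum_add_collapseDrop_le h.1 h.2.2.1 j
  have h2 := h.2.2.2 b hb hsum (fun i => by have := hpsum i; omega) j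
  have h3 := hpsum j
  omega

lemma even_card_filter_of_isTypeC {e : Multiset ℕ} (he : IsTypeC e) (x : ℕ) :
    Even (Multiset.card (e.filter (fun y => Odd y ∧ x < y))) := by
  refine even_card_of_even_count fun y hy => ?_
  have hy' := (Multiset.mem_filter.1 hy).2
  rw [Multiset.count_filter, if_pos hy']
  exact he.2.2 y hy'.1

lemma card_filter_lt_eq (s : Multiset ℕ) (x : ℕ) :
    Multiset.card (s.filter (fun y => x < y)) =
      Multiset.card (s.filter (fun y => Odd y ∧ x < y)) + evenAbove s x := by
  have h := Multiset.filter_add_not (fun y => Odd y) (s.filter (fun y => x < y))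
  rw [Multiset.filter_filter, Multiset.filter_filter] at h
  simp only [Nat.not_odd_iff_even] at h
  rw [evenAbove, ← Multiset.card_add, h]

lemma even_card_odd_iff (s : Multiset ℕ) (x : ℕ) :
    Even (Multiset.card (s.filter (fun y => Odd y ∧ x < y))) ↔
      Even (s.filter (fun y => x < y)).sum := by
  induction s using Multiset.induction_on with
  | empty => simp
  | cons a s ih =>
    by_cases h : x < a
    · rw [Multiset.filter_cons_of_pos _ h, Multiset.sum_cons]
      by_cases ho : Odd a
      · rw [Multiset.filter_cons_of_pos _ ⟨ho, h⟩, Multiset.card_cons, Nat.even_add, Nat.even_add,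
          ih, ← Nat.not_odd_iff_even (n := a)]
        simp [ho]
      · rw [Multiset.filter_cons_of_neg _ (fun hc => ho hc.1), ih, Nat.even_add]
        simp [Nat.not_odd_iff_even.1 ho]
    · rw [Multiset.filter_cons_of_neg _ h, Multiset.filter_cons_of_neg _ (fun hc => h hc.2), ih]

/-- If even parts above every repeated odd part of `s` are even in number, the C-collapse of `s`
is special. -/
lemma IsCollapse.isSpecialE {s e : Multiset ℕ} (hs : Even s.sum)
    (h : IsCollapse IsTypeC s e)
    (hev : ∀ k, part s (k + 1) = part s (k + 2) → Odd (part s (k + 1)) →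
      Even (evenAbove s (part s (k + 1)))) : IsSpecialE e := by
  refine isSpecialE_of_even_evenAbove fun t ht => ?_
  obtain ⟨k, rfl⟩ : ∃ k, t = k + 1 := ⟨t - 1, by have := ht.1; omega⟩
  have hx := ht.2
  set x := part e (k + 1) with hxk
  set c := Multiset.card (e.filter (fun y => x < y)) with hc
  have hparte : part e (c + 1) = x := by
    refine le_antisymm (not_lt.1 ((lt_card_filter_iff e x c).not.1 (lt_irrefl _))) ?_
    have hck : c ≤ k := not_lt.1 ((lt_card_filter_iff e x k).not.2 (lt_irrefl _))
    exact part_antitone e hck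
  have hodde := even_card_filter_of_isTypeC h.1 x
  have hce : Even (psum e c) := by
    rw [hc, psum_card_filter, ← even_card_odd_iff]
    exact hodde
  have hce1 : Odd (psum e (c + 1)) := by
    rw [psum_succ, hparte]
    exact hce.add_odd hx
  have hsum := h.psum_add_collapseDrop hs (c + 1)
  have hle := collapseDrop_le_one s (c + 1)
  have hcs1 : Odd (psum s (c + 1)) := by
    by_contra hno
    rw [collapseDrop_of_even (Nat.not_odd_iff_even.1 hno)] at hsum
    exact hno (hsum ▸ hce1)
  have hd : collapseDrop s (c + 1) = 0 := by
    rw [Nat.odd_iff] at hce1 hcs1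
    omega
  obtain ⟨heq, ha⟩ : part s (c + 1) = part s (c + 1 + 1) ∧ Odd (part s (c + 1)) := by
    by_contra hno
    rw [collapseDrop, if_pos ⟨hcs1, hno⟩] at hd
    omega
  have hcs : Even (psum s c) := by
    rw [psum_succ, Nat.odd_add'] at hcs1
    exact hcs1.1 ha
  have hea := hev c heq ha
  have hparity : ∀ j, Multiset.card (s.filter (fun y => part s (c + 1) < y)) ≤ j → j ≤ c →
      (Even (psum s j) ↔ Even j) := by
    intro j hj
    induction j, hj using Nat.le_induction with
    | base =>
      intro _
      rw [psum_card_filter, ← even_card_odd_iff, card_filter_lt_eq, Nat.even_add]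
      simp [hea]
    | succ j hj ih =>
      intro hjc
      have h1 : part s (j + 1) ≤ part s (c + 1) :=
        not_lt.1 ((lt_card_filter_iff s (part s (c + 1)) j).not.1 (not_lt.2 hj))
      have h2 : part s (c + 1) ≤ part s (j + 1) := part_antitone s (show j ≤ c by omega)
      rw [psum_succ, le_antisymm h1 h2, Nat.even_add, Nat.even_add_one, ih (by omega)]
      simp [Nat.not_even_iff_odd.2 ha]
  have hcc := (hparity c (not_lt.1 ((lt_card_filter_iff s (part s (c + 1)) c).not.2
    (lt_irrefl _))) le_rfl).1 hcs
  rw [hc, card_filter_lt_eq, Nat.even_add] at hcc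
  exact hcc.1 hodde

/-! ### Transposes and the removal of even parts -/

lemma part_one_ge {s : Multiset ℕ} {x : ℕ} (hx : x ∈ s) : x ≤ part s 1 := by
  obtain ⟨k, rfl⟩ := exists_part_eq hx
  exact part_antitone s (Nat.zero_le k)

lemma sum_card_filter_le (s : Multiset ℕ) (M : ℕ) (h : ∀ x ∈ s, x ≤ M) :
    ∑ j ∈ Finset.range M, Multiset.card (s.filter (fun x => j + 1 ≤ x)) = s.sum := by
  induction s using Multiset.induction_on with
  | empty => simp
  | cons a s ih =>
    have ha := h a (Multiset.mem_cons_self a s)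
    simp only [Multiset.filter_cons, Multiset.card_add, Finset.sum_add_distrib, Multiset.sum_cons]
    rw [ih fun x hx => h x (Multiset.mem_cons_of_mem hx)]
    congr 1
    have h1 : ∀ j, Multiset.card (if j + 1 ≤ a then ({a} : Multiset ℕ) else 0) =
        if j < a then 1 else 0 := fun j => by
      simp only [Nat.succ_le_iff]
      split_ifs <;> simp
    simp only [h1]
    rw [← Finset.sum_filter, Finset.sum_const, smul_eq_mul, mul_one]
    have h2 : (Finset.range M).filter (fun j => j < a) = Finset.range a := by
      ext j
      simp only [Finset.mem_filter, Finset.mem_range]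
      omega
    rw [h2, Finset.card_range]

lemma sum_transpose (s : Multiset ℕ) : (transpose s).sum = s.sum :=
  sum_card_filter_le s (part s 1) fun _ => part_one_ge

lemma posParts_transpose (s : Multiset ℕ) : PosParts (transpose s) := by
  intro x hx
  obtain ⟨j, hj, rfl⟩ := Multiset.mem_map.1 hx
  rw [Multiset.mem_range] at hj
  rw [Multiset.card_pos_iff_exists_mem]
  exact ⟨part s 1, Multiset.mem_filter.2 ⟨part_mem (k := 0) (by rw [Nat.zero_add]; omega), hj⟩⟩

lemma count_muEven (T : Multiset ℕ) (x : ℕ) :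
    (muEven T).count x =
      if x ∈ T ∧ Even x then (if Even (T.count x) then 2 else 1) else 0 := by
  rw [muEven, Multiset.count_bind]
  have h1 : ∀ y : ℕ, Multiset.count x (Multiset.replicate (if Even (T.count y) then 2 else 1) y) =
      if x = y then (if Even (T.count x) then 2 else 1) else 0 := fun y => by
    rw [Multiset.count_replicate]
    by_cases h : x = y
    · subst h; simp
    · rw [if_neg h, if_neg (Ne.symm h)]
  simp only [h1]
  rw [Finset.sum_map_val, Finset.sum_ite_eq]
  simp

lemma even_sum_muEven (T : Multiset ℕ) : Even (muEven T).sum := by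
  refine even_sum_of_odd_count fun x hx => ?_
  rw [count_muEven, if_neg fun h => Nat.not_even_iff_odd.2 hx h.2]
  exact Even.zero

lemma muEven_le (T : Multiset ℕ) : muEven T ≤ T := by
  rw [Multiset.le_iff_count]
  intro x
  rw [count_muEven]
  split_ifs with h h'
  · have := Multiset.count_pos.2 h.1
    rw [Nat.even_iff] at h'
    omega
  · exact Multiset.count_pos.2 h.1
  · exact Nat.zero_le _

lemma isTypeB_sub_muEven {T : Multiset ℕ} (hpos : PosParts T) (hsum : Odd T.sum) :
    IsTypeB (T - muEven T) := by
  refine ⟨fun x hx => hpos x (Multiset.mem_of_le (Multiset.sub_le_self _ _) hx), ?_,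
    fun x hx => ?_⟩
  · have h := congrArg Multiset.sum (Multiset.sub_add_cancel (muEven_le T))
    rw [Multiset.sum_add] at h
    rw [← h, Nat.odd_add] at hsum
    exact hsum.2 (even_sum_muEven T)
  · rw [Multiset.count_sub, count_muEven]
    split_ifs with h h'
    · rw [Nat.even_iff] at h' ⊢
      omega
    · rw [Nat.even_iff] at h' ⊢
      omega
    · have : T.count x = 0 := Multiset.count_eq_zero_of_notMem fun hm => h ⟨hm, hx⟩
      rw [this]
      exact Even.zero

/-- For a B-partition `λ` of `n ≥ 1` with `ν = λᵗ ∖ μ(λ)`: if the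
smallest part of `ν` is even then `ν⁻` is quasi-special; if it is odd then `ν⁻`
is special; and in either case the C-collapse `(ν⁻)_C` is special. -/
theorem statement5 (n : ℕ) (hn : 1 ≤ n) (l : Multiset ℕ)
    (hB : IsTypeB l ∧ l.sum = 2 * n + 1) :
    (Even (minPart (transpose l - muEven (transpose l))) →
      IsQuasiSpecialE (decMin (transpose l - muEven (transpose l)))) ∧
    (Odd (minPart (transpose l - muEven (transpose l))) →
      IsSpecialE (decMin (transpose l - muEven (transpose l)))) ∧
    (∀ e, IsCollapse IsTypeC (decMin (transpose l - muEven (transpose l))) e →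
      IsSpecialE e) := by
  have hB' : IsTypeB (transpose l - muEven (transpose l)) :=
    isTypeB_sub_muEven (posParts_transpose l) (sum_transpose l ▸ hB.1.2.1)
  exact ⟨hB'.isQuasiSpecialE_decMin, hB'.isSpecialE_decMin, fun e he =>
    he.isSpecialE hB'.even_sum_decMin fun k hk ho =>
      hB'.even_evenAbove_decMin (part_mem ho.pos)
        (hk ▸ hB'.part_ne_of_part_eq (Nat.lt_succ_self k) hk (hk ▸ ho))⟩

end WFPaper
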